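/- Let ε ∈ (0, 3/4), λ > 0, and X ∈ St(p,n)^ε. Then for every g ∈ ℝ^{n×p}, ‖Λ̃(X;g)‖_F² ≤ ‖skew(g Xᵀ)X‖_F² + 4λ²(1+ε)·N(X), where N(X) := (1/4)‖XᵀX − I_p‖_F². -/

import Mathlib

open Matrix Finset

noncomputable section

/-- Frobenius inner product `⟨A, B⟩ = Tr (Aᵀ * B)`. -/
def finner {n p : ℕ} (A B : Matrix (Fin n) (Fin p) ℝ) : ℝ :=
  (Aᵀ * B).trace

/-- Frobenius norm `‖A‖_F = √(Tr (Aᵀ * A))`. -/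
def fnorm {n p : ℕ} (A : Matrix (Fin n) (Fin p) ℝ) : ℝ :=
  Real.sqrt ((Aᵀ * A).trace)

/-- Skew-symmetric part `skew M = (M - Mᵀ)/2`. -/
def skewPart {m : ℕ} (M : Matrix (Fin m) (Fin m) ℝ) : Matrix (Fin m) (Fin m) ℝ :=
  (1 / 2 : ℝ) • (M - Mᵀ)

/-- Symmetric part `sym M = (M + Mᵀ)/2`. -/
def symPart {m : ℕ} (M : Matrix (Fin m) (Fin m) ℝ) : Matrix (Fin m) (Fin m) ℝ :=
  (1 / 2 : ℝ) • (M + Mᵀ)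

/-- Penalty function `N(X) = ‖XᵀX - I‖_F² / 4`. -/
def penaltyN {n p : ℕ} (X : Matrix (Fin n) (Fin p) ℝ) : ℝ :=
  (1 / 4 : ℝ) * fnorm (Xᵀ * X - 1) ^ 2

/-- Landing direction `Λ̃(X; g) = skew(g Xᵀ) X + λ X (XᵀX - I)` with gradient estimate `g`. -/
def landingDir {n p : ℕ} (lam : ℝ) (X g : Matrix (Fin n) (Fin p) ℝ) :
    Matrix (Fin n) (Fin p) ℝ :=
  skewPart (g * Xᵀ) * X + lam • (X * (Xᵀ * X - 1))

lemma trace_transpose_mul_eq_sum {n p : ℕ} (A B : Matrix (Fin n) (Fin p) ℝ) :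
    (Aᵀ * B).trace = ∑ x : Fin n × Fin p, A x.1 x.2 * B x.1 x.2 := by
  simp only [trace, diag_apply, mul_apply, transpose_apply, Fintype.sum_prod_type]
  exact Finset.sum_comm

lemma trace_transpose_mul_self_nonneg {n p : ℕ} (A : Matrix (Fin n) (Fin p) ℝ) :
    0 ≤ (Aᵀ * A).trace := by
  rw [trace_transpose_mul_eq_sum]
  exact Finset.sum_nonneg fun x _ => mul_self_nonneg _

lemma fnorm_sq {n p : ℕ} (A : Matrix (Fin n) (Fin p) ℝ) :
    fnorm A ^ 2 = (Aᵀ * A).trace :=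
  Real.sq_sqrt (trace_transpose_mul_self_nonneg A)

lemma fnorm_nonneg {n p : ℕ} (A : Matrix (Fin n) (Fin p) ℝ) : 0 ≤ fnorm A :=
  Real.sqrt_nonneg _

/-- Cauchy–Schwarz inequality for the Frobenius inner product. -/
lemma trace_transpose_mul_le {n p : ℕ} (A B : Matrix (Fin n) (Fin p) ℝ) :
    (Aᵀ * B).trace ≤ fnorm A * fnorm B := by
  refine le_of_sq_le_sq ?_ (mul_nonneg (fnorm_nonneg A) (fnorm_nonneg B))
  rw [mul_pow, fnorm_sq, fnorm_sq]
  simp only [trace_transpose_mul_eq_sum, ← pow_two]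
  exact Finset.sum_mul_sq_le_sq_mul_sq _ _ _

/-- The Frobenius norm is submultiplicative. -/
lemma fnorm_mul_le {m n p : ℕ} (A : Matrix (Fin m) (Fin n) ℝ) (B : Matrix (Fin n) (Fin p) ℝ) :
    fnorm (A * B) ≤ fnorm A * fnorm B := by
  refine le_of_sq_le_sq ?_ (mul_nonneg (fnorm_nonneg A) (fnorm_nonneg B))
  rw [mul_pow, fnorm_sq, fnorm_sq, fnorm_sq]
  simp only [trace_transpose_mul_eq_sum, ← pow_two, Fintype.sum_prod_type]
  rw [Finset.sum_comm (f := fun k j => B k j ^ 2), Finset.sum_mul_sum]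
  refine Finset.sum_le_sum fun i _ => Finset.sum_le_sum fun j _ => ?_
  rw [mul_apply]
  exact Finset.sum_mul_sq_le_sq_mul_sq _ _ _

lemma transpose_skewPart {m : ℕ} (M : Matrix (Fin m) (Fin m) ℝ) :
    (skewPart M)ᵀ = -skewPart M := by
  simp [skewPart, ← smul_neg]

/-- A skew-symmetric and a symmetric matrix are orthogonal. -/
lemma trace_mul_eq_zero_of_skew_of_symm {m : ℕ} {S M : Matrix (Fin m) (Fin m) ℝ}
    (hS : Sᵀ = -S) (hM : Mᵀ = M) : (S * M).trace = 0 := by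
  have h : (S * M).trace = -(S * M).trace := by
    conv_lhs => rw [← trace_transpose, transpose_mul, hS, hM, trace_mul_comm, neg_mul, trace_neg]
  linarith

lemma transpose_gram_sub_one {n p : ℕ} (X : Matrix (Fin n) (Fin p) ℝ) :
    (Xᵀ * X - 1)ᵀ = Xᵀ * X - 1 := by
  simp

/-- The tangential and the normal component of the landing direction are orthogonal. -/
lemma trace_transpose_skewPart_mul {n p : ℕ} (M : Matrix (Fin n) (Fin n) ℝ)
    (X : Matrix (Fin n) (Fin p) ℝ) :
    ((skewPart M * X)ᵀ * (X * (Xᵀ * X - 1))).trace = 0 := by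
  have h : (skewPart M * (X * (Xᵀ * X - 1) * Xᵀ)).trace = 0 :=
    trace_mul_eq_zero_of_skew_of_symm (transpose_skewPart M) (by
      rw [transpose_mul, transpose_mul, transpose_gram_sub_one, transpose_transpose,
        Matrix.mul_assoc])
  rw [transpose_mul, transpose_skewPart, Matrix.mul_assoc, trace_mul_comm, Matrix.mul_assoc,
    neg_mul, trace_neg, h, neg_zero]

lemma fnorm_add_smul_sq {n p : ℕ} (c : ℝ) (A B : Matrix (Fin n) (Fin p) ℝ)
    (h : (Aᵀ * B).trace = 0) :
    fnorm (A + c • B) ^ 2 = fnorm A ^ 2 + c ^ 2 * fnorm B ^ 2 := by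
  have h' : (Bᵀ * A).trace = 0 := by
    rw [← trace_transpose, transpose_mul, transpose_transpose, h]
  simp only [fnorm_sq, transpose_add, transpose_smul, Matrix.add_mul, Matrix.mul_add, trace_add,
    Matrix.smul_mul, Matrix.mul_smul, trace_smul, h, h', smul_eq_mul]
  ring

lemma fnorm_mul_gram_sub_one_sq_le {n p : ℕ} (X : Matrix (Fin n) (Fin p) ℝ) :
    fnorm (X * (Xᵀ * X - 1)) ^ 2 ≤ (1 + fnorm (Xᵀ * X - 1)) * fnorm (Xᵀ * X - 1) ^ 2 := by
  set D := Xᵀ * X - 1 with hD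
  have hX : Xᵀ * X = 1 + D := by rw [hD]; abel
  have hs : Dᵀ = D := transpose_gram_sub_one X
  have h₁ : fnorm (X * D) ^ 2 = fnorm D ^ 2 + (Dᵀ * (D * D)).trace := by
    rw [fnorm_sq, fnorm_sq, transpose_mul, Matrix.mul_assoc, ← Matrix.mul_assoc Xᵀ, hX,
      Matrix.add_mul, Matrix.one_mul, Matrix.mul_add, trace_add]
  have h₂ := trace_transpose_mul_le D (D * D)
  have h₃ := mul_le_mul_of_nonneg_left (fnorm_mul_le D D) (fnorm_nonneg D)
  linarith

/-- for `X` in the safe region,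
`‖Λ̃(X;g)‖_F² ≤ ‖skew(g Xᵀ) X‖_F² + 4λ²(1+ε) N(X)`. -/
theorem landing_direction_norm_bound {n p : ℕ} (ε lam : ℝ)
    (hε : ε ∈ Set.Ioo (0 : ℝ) (3 / 4)) (hlam : 0 < lam)
    (X : Matrix (Fin n) (Fin p) ℝ) (hX : fnorm (Xᵀ * X - 1) ≤ ε) :
    ∀ g : Matrix (Fin n) (Fin p) ℝ,
      fnorm (landingDir lam X g) ^ 2 ≤
        fnorm (skewPart (g * Xᵀ) * X) ^ 2 + 4 * lam ^ 2 * (1 + ε) * penaltyN X := by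
  intro g
  rw [landingDir, fnorm_add_smul_sq _ _ _ (trace_transpose_skewPart_mul _ _), penaltyN]
  have h₁ : fnorm (X * (Xᵀ * X - 1)) ^ 2 ≤ (1 + ε) * fnorm (Xᵀ * X - 1) ^ 2 :=
    (fnorm_mul_gram_sub_one_sq_le X).trans (by gcongr)
  have h₂ := mul_le_mul_of_nonneg_left h₁ (sq_nonneg lam)
  linarith
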